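/- arXiv:2401.07988 — 2 statements merged into one kernel-verified Lean document; each statement's English description precedes it below -/
import Mathlib

section
/- Let s ≥ 0 be a real number. Then the function γ ↦ log(1 + γ) − γ + (1 + γ)·s/(1 + s), defined for γ ≥ 0, attains its maximum value log(1 + s) uniquely at γ = s. (This is the Lagrangian dual reformulation the paper uses to take the SINDR out of the logarithm, with the optimal auxiliary variable γ_k^opt equal to the optimal SINDR of user k.) -/
/-- **Lagrangian dual reformulation of the rate.** For `s ≥ 0`, the function
`γ ↦ log(1+γ) − γ + (1+γ) s/(1+s)` on `γ ≥ 0` attains its maximum value `log(1+s)`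
uniquely at `γ = s`. -/
theorem stmt_11 (s : ℝ) (hs : 0 ≤ s) :
    (∀ γ : ℝ, 0 ≤ γ →
      Real.log (1 + γ) - γ + (1 + γ) * s / (1 + s) ≤ Real.log (1 + s)) ∧
    (Real.log (1 + s) - s + (1 + s) * s / (1 + s) = Real.log (1 + s)) ∧
    ∀ γ : ℝ, 0 ≤ γ →
      Real.log (1 + γ) - γ + (1 + γ) * s / (1 + s) = Real.log (1 + s) → γ = s := by
  have h1 : 0 < 1 + s := by linarith
  have key : ∀ γ : ℝ, 0 ≤ γ → Real.log (1 + γ) - γ + (1 + γ) * s / (1 + s)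
      = Real.log (1 + s) + (Real.log ((1 + γ) / (1 + s)) - ((1 + γ) / (1 + s) - 1)) := by
    intro γ hγ
    have h2 : 0 < 1 + γ := by linarith
    rw [Real.log_div h2.ne' h1.ne']
    have h3 : (1 + γ) * s / (1 + s) = (1 + γ) - (1 + γ) / (1 + s) := by
      field_simp
      ring
    rw [h3]
    ring
  refine ⟨?_, ?_, ?_⟩
  · intro γ hγ
    have h2 : 0 < (1 + γ) / (1 + s) := by positivity
    have h3 := Real.log_le_sub_one_of_pos h2
    rw [key γ hγ]
    linarith
  · rw [key s hs, div_self h1.ne']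
    simp
  · intro γ hγ h
    have h2 : 0 < (1 + γ) / (1 + s) := by positivity
    rw [key γ hγ] at h
    by_contra hne
    have h4 : (1 + γ) / (1 + s) ≠ 1 := by
      intro h5
      rw [div_eq_one_iff_eq h1.ne'] at h5
      exact hne (by linarith)
    have h3 := Real.log_lt_sub_one_of_pos h2 h4
    linarith
end

section
/- Let X and W be independent real standard Gaussian random variables (mean 0, variance 1), and let a, b ∈ ℝ with (a, b) ≠ (0, 0). Set Y = a·X + b·W. Then E[X · sgn(Y)] = √(2/π) · a/√(a² + b²). (This is the cross-correlation identity between a Gaussian input and the sign of a correlated Gaussian, used to compute the matrix C_zr = √(2η/π)·C_z·Diag(C_z)^{-1/2} for 1-bit quantization.) -/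
open MeasureTheory ProbabilityTheory

lemma aux_abs : ∫ x, |x| ∂(gaussianReal 0 1) = Real.sqrt (2 / Real.pi) := by
  rw [integral_gaussianReal_eq_integral_smul one_ne_zero]
  have h1 : ∀ x : ℝ, gaussianPDFReal 0 1 x • |x|
      = (fun y : ℝ => (Real.sqrt (2 * Real.pi))⁻¹ * (y ^ (1:ℝ) * Real.exp (-(1/2) * y ^ (2:ℝ)))) |x| := by
    intro x
    simp only [gaussianPDFReal, Real.rpow_one, Real.rpow_two, sq_abs, smul_eq_mul, NNReal.coe_one,
      mul_one, sub_zero]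
    rw [show -x ^ 2 / 2 = -(1/2) * x ^ 2 by ring]
    ring
  rw [integral_congr_ae (ae_of_all _ h1)]
  rw [integral_comp_abs (f := fun y : ℝ => (Real.sqrt (2 * Real.pi))⁻¹ * (y ^ (1:ℝ) * Real.exp (-(1/2) * y ^ (2:ℝ)))),
    integral_const_mul,
    integral_rpow_mul_exp_neg_mul_rpow (by norm_num) (by norm_num) (by norm_num)]
  norm_num [Real.rpow_neg_one]
  have h2 := Real.mul_self_sqrt (show (0:ℝ) ≤ 2 by norm_num)
  have h3 : Real.sqrt 2 ≠ 0 := by positivity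
  have h4 : Real.sqrt Real.pi ≠ 0 := by positivity
  field_simp
  nlinarith

lemma aux_meas : Measurable Real.sign := by
  unfold Real.sign
  exact Measurable.ite measurableSet_Iio measurable_const
    (Measurable.ite measurableSet_Ioi measurable_const measurable_const)

lemma aux_bd (x : ℝ) : ‖Real.sign x‖ ≤ 1 := by
  rcases Real.sign_apply_eq x with h | h | h <;> simp [h]

lemma aux_unit {Ω : Type*} [MeasureSpace Ω] [IsProbabilityMeasure (ℙ : Measure Ω)]
    (X W : Ω → ℝ) (hXm : Measurable X) (hWm : Measurable W)
    (hX : Measure.map X ℙ = gaussianReal 0 1)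
    (hW : Measure.map W ℙ = gaussianReal 0 1)
    (hindep : IndepFun X W ℙ)
    (c d : ℝ) (hcd : c ^ 2 + d ^ 2 = 1) :
    ∫ ω, X ω * Real.sign (c * X ω + d * W ω) ∂ℙ = Real.sqrt (2 / Real.pi) * c := by
  have gX : HasGaussianLaw X (ℙ : Measure Ω) := ⟨by rw [hX]; infer_instance⟩
  have gW : HasGaussianLaw W (ℙ : Measure Ω) := ⟨by rw [hW]; infer_instance⟩
  have gXW := hindep.hasGaussianLaw gX gW
  have mX := gX.memLp_two
  have mW := gW.memLp_two
  have vX : Var[X; (ℙ : Measure Ω)] = 1 := by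
    have := variance_map (X := id) (Y := X) (μ := (ℙ : Measure Ω)) aemeasurable_id hXm.aemeasurable
    rw [hX, variance_id_gaussianReal] at this
    simpa using this.symm
  have vW : Var[W; (ℙ : Measure Ω)] = 1 := by
    have := variance_map (X := id) (Y := W) (μ := (ℙ : Measure Ω)) aemeasurable_id hWm.aemeasurable
    rw [hW, variance_id_gaussianReal] at this
    simpa using this.symm
  have eX : ∫ ω, X ω ∂(ℙ : Measure Ω) = 0 := by
    have := integral_map (μ := (ℙ : Measure Ω)) hXm.aemeasurable
      (f := fun x : ℝ => x) aestronglyMeasurable_id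
    rw [hX, integral_id_gaussianReal] at this
    exact this.symm
  have eW : ∫ ω, W ω ∂(ℙ : Measure Ω) = 0 := by
    have := integral_map (μ := (ℙ : Measure Ω)) hWm.aemeasurable
      (f := fun x : ℝ => x) aestronglyMeasurable_id
    rw [hW, integral_id_gaussianReal] at this
    exact this.symm
  set U : Ω → ℝ := c • X + d • W with hU
  set V : Ω → ℝ := d • X - c • W with hV
  have cXW := hindep.covariance_eq_zero mX mW
  have cWX := hindep.symm.covariance_eq_zero mW mX
  have gUV : HasGaussianLaw (fun ω ↦ (U ω, V ω)) (ℙ : Measure Ω) :=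
    gXW.map_fun (((c • ContinuousLinearMap.fst ℝ ℝ ℝ + d • ContinuousLinearMap.snd ℝ ℝ ℝ).prod
      (d • ContinuousLinearMap.fst ℝ ℝ ℝ - c • ContinuousLinearMap.snd ℝ ℝ ℝ)))
  have cXX : cov[X, X; (ℙ : Measure Ω)] = 1 := by rw [covariance_self hXm.aemeasurable, vX]
  have cWW : cov[W, W; (ℙ : Measure Ω)] = 1 := by rw [covariance_self hWm.aemeasurable, vW]
  have iUV : IndepFun U V (ℙ : Measure Ω) := by
    apply gUV.indepFun_of_covariance_eq_zero
    rw [hU, hV, covariance_add_left (mX.const_smul c) (mW.const_smul d)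
      ((mX.const_smul d).sub (mW.const_smul c)),
      covariance_sub_right (mX.const_smul c) (mX.const_smul d) (mW.const_smul c),
      covariance_sub_right (mW.const_smul d) (mX.const_smul d) (mW.const_smul c)]
    simp only [covariance_smul_left, covariance_smul_right, cXW, cWX, cXX, cWW]
    ring
  have lU : Measure.map U ℙ = gaussianReal 0 1 := by
    have h1 : Measure.map (c • X) ℙ = gaussianReal (c * 0) (NNReal.mk (c ^ 2) (sq_nonneg c) * 1) := by
      rw [← gaussianReal_map_const_mul, ← hX, Measure.map_map (by fun_prop) hXm]; rfl
    have h2 : Measure.map (d • W) ℙ = gaussianReal (d * 0) (NNReal.mk (d ^ 2) (sq_nonneg d) * 1) := by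
      rw [← gaussianReal_map_const_mul, ← hW, Measure.map_map (by fun_prop) hWm]; rfl
    have h3 : IndepFun (c • X) (d • W) (ℙ : Measure Ω) :=
      hindep.comp (φ := fun x => c * x) (ψ := fun x => d * x) (by fun_prop) (by fun_prop)
    rw [hU, gaussianReal_add_gaussianReal_of_indepFun h3 h1 h2]
    congr 1
    · simp
    · ext; simpa using hcd
  have mU : Measurable U := (hXm.const_smul c).add (hWm.const_smul d)
  have mV : Measurable V := (hXm.const_smul d).sub (hWm.const_smul c)
  have mS : Measurable (fun ω => Real.sign (U ω)) := aux_meas.comp mU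
  have hd : ∀ ω, X ω * Real.sign (c * X ω + d * W ω)
      = c * |U ω| + d * (V ω * Real.sign (U ω)) := by
    intro ω
    have e1 : c * X ω + d * W ω = U ω := rfl
    have e2 : X ω = c * U ω + d * V ω := by
      simp only [hU, hV, Pi.add_apply, Pi.sub_apply, Pi.smul_apply, smul_eq_mul]
      linear_combination (-X ω) * hcd
    have e3 : U ω * Real.sign (U ω) = |U ω| := by
      rcases lt_trichotomy (U ω) 0 with h | h | h
      · rw [Real.sign_of_neg h, abs_of_neg h]; ring
      · simp [h]
      · rw [Real.sign_of_pos h, abs_of_pos h]; ring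
    rw [e1, ← e3]
    linear_combination Real.sign (U ω) * e2
  have iV : Integrable V (ℙ : Measure Ω) := gUV.snd.integrable
  have eV : ∫ ω, V ω ∂(ℙ : Measure Ω) = 0 := by
    have : ∫ ω, V ω ∂(ℙ : Measure Ω) = ∫ ω, (d * X ω - c * W ω) ∂(ℙ : Measure Ω) := rfl
    rw [this, integral_sub (gX.integrable.const_mul d) (gW.integrable.const_mul c),
      integral_const_mul, integral_const_mul, eX, eW]
    simp
  have eVS : ∫ ω, V ω * Real.sign (U ω) ∂(ℙ : Measure Ω) = 0 := by
    have h := (iUV.symm.comp measurable_id aux_meas).integral_fun_mul_eq_mul_integral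
      mV.aestronglyMeasurable mS.aestronglyMeasurable
    refine h.trans ?_
    simp only [Function.comp_def, id, eV, zero_mul]
  have eU : ∫ ω, |U ω| ∂(ℙ : Measure Ω) = Real.sqrt (2 / Real.pi) := by
    rw [← aux_abs, ← lU, integral_map mU.aemeasurable (by fun_prop)]
  have iVS : Integrable (fun ω => V ω * Real.sign (U ω)) (ℙ : Measure Ω) :=
    iV.mul_bdd (c := 1) mS.aestronglyMeasurable (ae_of_all _ fun ω => aux_bd _)
  simp_rw [hd]
  rw [integral_add (gUV.fst.integrable.abs.const_mul c) (iVS.const_mul d),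
    integral_const_mul, integral_const_mul, eVS, eU]
  ring

/-- **Cross-correlation of a Gaussian with the sign of a correlated Gaussian.** If `X, W` are
independent standard real Gaussians and `Y = a X + b W` with `(a, b) ≠ (0, 0)`, then
`E[X · sgn(Y)] = √(2/π) · a / √(a² + b²)`. -/
theorem stmt_14 {Ω : Type*} [MeasureSpace Ω] [IsProbabilityMeasure (ℙ : Measure Ω)]
    (X W : Ω → ℝ) (hXm : Measurable X) (hWm : Measurable W)
    (hX : Measure.map X ℙ = gaussianReal 0 1)
    (hW : Measure.map W ℙ = gaussianReal 0 1)
    (hindep : IndepFun X W ℙ)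
    (a b : ℝ) (hab : (a, b) ≠ (0, 0)) :
    ∫ ω, X ω * Real.sign (a * X ω + b * W ω) ∂ℙ
      = Real.sqrt (2 / Real.pi) * (a / Real.sqrt (a ^ 2 + b ^ 2)) := by
  have hp : 0 < a ^ 2 + b ^ 2 := by
    by_contra h
    apply hab
    have ha : a = 0 := by nlinarith [sq_nonneg a, sq_nonneg b]
    have hb : b = 0 := by nlinarith [sq_nonneg a, sq_nonneg b]
    rw [ha, hb]
  set s := Real.sqrt (a ^ 2 + b ^ 2) with hs
  have hs0 : 0 < s := Real.sqrt_pos.2 hp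
  have hs2 : s ^ 2 = a ^ 2 + b ^ 2 := Real.sq_sqrt hp.le
  rw [← aux_unit X W hXm hWm hX hW hindep (a / s) (b / s) (by
    rw [div_pow, div_pow, ← add_div, ← hs2, div_self (by positivity)])]
  congr 1
  ext ω
  congr 1
  rw [show a / s * X ω + b / s * W ω = (a * X ω + b * W ω) / s by ring]
  rcases lt_trichotomy (a * X ω + b * W ω) 0 with h | h | h
  · rw [Real.sign_of_neg h, Real.sign_of_neg (div_neg_of_neg_of_pos h hs0)]
  · simp [h]
  · rw [Real.sign_of_pos h, Real.sign_of_pos (div_pos h hs0)]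
end
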